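/- For a unitary finite-dimensional representation \rho of SL_2(\mathbb{Z}) that is irreducible and nontrivial, every quasimodular form of weight 2 and type \rho is a genuine modular form: if F: \mathbb{H} \to V(\rho) is holomorphic, F + y^{-1}F_2 transforms with weight 2 under \rho for some holomorphic F_2 bounded at infinity, and F is bounded at infinity, then F_2 = 0 and F is a holomorphic modular form of weight 2 and type \rho. -/

import Mathlib

open scoped MatrixGroups

section

variable {V : Type*} [NormedAddCommGroup V] [NormedSpace ℂ V]

/-- If `f` and `Im • f` are both holomorphic on the upper half-plane, then `f = 0`. -/
lemma eq_zero_of_eq_im_smul {f g : ℂ → V}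
    (hf : DifferentiableOn ℂ f {z : ℂ | 0 < z.im})
    (hg : DifferentiableOn ℂ g {z : ℂ | 0 < z.im})
    (h : ∀ z : ℂ, 0 < z.im → g z = z.im • f z) {z : ℂ} (hz : 0 < z.im) : f z = 0 := by
  have hU : {z : ℂ | 0 < z.im} ∈ nhds z :=
    (isOpen_lt continuous_const Complex.continuous_im).mem_nhds hz
  have hf' := (hf.differentiableAt hU).hasFDerivAt.restrictScalars ℝ
  have hg' := (hg.differentiableAt hU).hasFDerivAt.restrictScalars ℝ
  have him : HasFDerivAt Complex.im Complex.imCLM z := Complex.imCLM.hasFDerivAt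
  have heq : g =ᶠ[nhds z] fun w => w.im • f w := by
    filter_upwards [hU] with w hw using h w hw
  have huniq := hg'.unique ((him.smul hf').congr_of_eventuallyEq heq)
  have h1 := DFunLike.congr_fun huniq 1
  have hI := DFunLike.congr_fun huniq Complex.I
  have hgI : fderiv ℂ g z Complex.I = Complex.I • fderiv ℂ g z 1 := by
    rw [← map_smul, smul_eq_mul, mul_one]
  have hfI : fderiv ℂ f z Complex.I = Complex.I • fderiv ℂ f z 1 := by
    rw [← map_smul, smul_eq_mul, mul_one]
  simp only [ContinuousLinearMap.coe_restrictScalars', add_apply,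
    smul_apply, ContinuousLinearMap.smulRight_apply, Complex.imCLM_apply,
    Complex.one_im, Complex.I_im, zero_smul, one_smul, add_zero] at h1 hI
  rw [hgI, hfI, h1, smul_comm] at hI
  simpa using hI

/-- The image of a point of the upper half-plane under a modular transformation, written out as
a fractional linear transformation. -/
lemma UpperHalfPlane.coe_smul_eq_int_div (γ : SL(2, ℤ)) (τ : UpperHalfPlane) :
    ((γ • τ : UpperHalfPlane) : ℂ) = (((γ.1 0 0 : ℤ) : ℂ) * τ + ((γ.1 0 1 : ℤ) : ℂ)) /
      (((γ.1 1 0 : ℤ) : ℂ) * τ + ((γ.1 1 1 : ℤ) : ℂ)) := by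
  rw [UpperHalfPlane.coe_specialLinearGroup_apply]
  simp

lemma int_mul_add_ne_zero (γ : SL(2, ℤ)) {z : ℂ} (hz : 0 < z.im) :
    ((γ.1 1 0 : ℤ) : ℂ) * z + ((γ.1 1 1 : ℤ) : ℂ) ≠ 0 := by
  have h := UpperHalfPlane.denom_ne_zero (γ : GL (Fin 2) ℝ) ⟨z, hz⟩
  simpa [UpperHalfPlane.denom] using h

lemma im_int_div (γ : SL(2, ℤ)) {z : ℂ} (hz : 0 < z.im) :
    ((((γ.1 0 0 : ℤ) : ℂ) * z + ((γ.1 0 1 : ℤ) : ℂ)) /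
      (((γ.1 1 0 : ℤ) : ℂ) * z + ((γ.1 1 1 : ℤ) : ℂ))).im =
    z.im / Complex.normSq (((γ.1 1 0 : ℤ) : ℂ) * z + ((γ.1 1 1 : ℤ) : ℂ)) := by
  have h := ModularGroup.im_smul_eq_div_normSq γ ⟨z, hz⟩
  rw [← UpperHalfPlane.coe_im, UpperHalfPlane.coe_smul_eq_int_div] at h
  simpa [UpperHalfPlane.denom] using h

lemma im_int_div_pos (γ : SL(2, ℤ)) {z : ℂ} (hz : 0 < z.im) :
    0 < ((((γ.1 0 0 : ℤ) : ℂ) * z + ((γ.1 0 1 : ℤ) : ℂ)) /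
      (((γ.1 1 0 : ℤ) : ℂ) * z + ((γ.1 1 1 : ℤ) : ℂ))).im := by
  rw [im_int_div γ hz]
  exact div_pos hz (Complex.normSq_pos.2 (int_mul_add_ne_zero γ hz))

/-- A holomorphic function on the upper half-plane, bounded on `{A ≤ Im z}`, is bounded there by
any bound valid on the horizontal line `Im z = A`. -/
lemma norm_le_of_norm_le_on_horizontal_line {f : ℂ → V}
    (hf : DifferentiableOn ℂ f {z : ℂ | 0 < z.im}) {A C M : ℝ} (hA : 0 < A)
    (hC : ∀ z : ℂ, A ≤ z.im → ‖f z‖ ≤ C) (hM : ∀ z : ℂ, z.im = A → ‖f z‖ ≤ M)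
    {z : ℂ} (hz : A ≤ z.im) : ‖f z‖ ≤ M := by
  set φ : ℂ → ℂ := fun w => Complex.I * w + Complex.I * A with hφ
  have him (w : ℂ) : (φ w).im = w.re + A := by simp [hφ]
  have hd : DiffContOnCl ℂ (fun w => f (φ w)) {w | 0 < w.re} := by
    apply DifferentiableOn.diffContOnCl
    rw [Complex.closure_setOfPred_lt_re]
    refine hf.comp (by fun_prop) fun w hw => ?_
    rw [Set.mem_ofPred_eq] at hw ⊢
    linarith [him w]
  have hbd (w : ℂ) (hw : 0 ≤ w.re) : ‖f (φ w)‖ ≤ C := hC _ (by linarith [him w])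
  have key := PhragmenLindelof.right_half_plane_of_bounded_on_real (C := M)
    (z := -Complex.I * z - A) hd ⟨0, by norm_num, 0, ?_⟩ ?_ ?_ (by simpa using hz)
  · convert key using 3
    simp only [hφ]
    linear_combination z * Complex.I_mul_I
  · refine Asymptotics.IsBigO.of_bound C ?_
    rw [Filter.eventually_inf_principal]
    refine Filter.Eventually.of_forall fun w hw => ?_
    simpa using hbd w (le_of_lt hw)
  · refine ⟨C, Filter.eventually_map.2 ?_⟩
    filter_upwards [Filter.eventually_ge_atTop 0] with x hx
    exact hbd x (by simpa using hx)
  · intro x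
    exact hM _ (by simp [him])

/-- A function on the upper half-plane which is holomorphic, bounded at infinity, and whose norm is
invariant under `SL(2, ℤ)` attains its maximal norm. -/
lemma exists_norm_le_of_norm_invariant {f : ℂ → V}
    (hf : DifferentiableOn ℂ f {z : ℂ | 0 < z.im}) {A C : ℝ}
    (hC : ∀ z : ℂ, A ≤ z.im → ‖f z‖ ≤ C)
    (hinv : ∀ (γ : SL(2, ℤ)) (τ : UpperHalfPlane), ‖f (γ • τ : UpperHalfPlane)‖ = ‖f τ‖) :
    ∃ z₀ : ℂ, 0 < z₀.im ∧ ∀ z : ℂ, 0 < z.im → ‖f z‖ ≤ ‖f z₀‖ := by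
  set B := max A 1 with hB
  have hB1 : 1 ≤ B := le_max_right _ _
  set K : Set ℂ := Set.Icc (-(1 / 2)) (1 / 2) ×ℂ Set.Icc (1 / 2) B with hK
  have hKc : IsCompact K := isCompact_Icc.reProdIm isCompact_Icc
  have hKU : K ⊆ {z : ℂ | 0 < z.im} := fun z hz => by
    rw [hK, Complex.mem_reProdIm] at hz
    exact lt_of_lt_of_le (by norm_num) hz.2.1
  obtain ⟨z₀, hz₀, hmax⟩ := hKc.exists_isMaxOn
    ⟨Complex.I, by rw [hK, Complex.mem_reProdIm]; norm_num; exact hB1⟩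
    (hf.continuousOn.mono hKU).norm
  have hline (z : ℂ) (hz : z.im = B) : ‖f z‖ ≤ ‖f z₀‖ := by
    have hz0 : 0 < z.im := by linarith
    have h := hinv (ModularGroup.T ^ (-round z.re)) ⟨z, hz0⟩
    rw [← h]
    apply hmax
    rw [UpperHalfPlane.modular_T_zpow_smul, hK, Complex.mem_reProdIm]
    have := abs_le.1 (abs_sub_round z.re)
    simp only [UpperHalfPlane.coe_vadd, Set.mem_Icc]
    simp
    refine ⟨⟨by linarith, by linarith⟩, by linarith, by linarith⟩
  refine ⟨z₀, hKU hz₀, fun z hz => ?_⟩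
  obtain ⟨γ, hγ⟩ := ModularGroup.exists_smul_mem_fd ⟨z, hz⟩
  have h := hinv γ ⟨z, hz⟩
  rw [← h]
  set τ := γ • (⟨z, hz⟩ : UpperHalfPlane)
  rcases le_total B τ.im with hτ | hτ
  · exact norm_le_of_norm_le_on_horizontal_line hf (by linarith)
      (fun w hw => hC w ((le_max_left _ _).trans hw)) hline hτ
  · apply hmax
    rw [hK, Complex.mem_reProdIm]
    have h3 := ModularGroup.three_le_four_mul_im_sq_of_mem_fd hγ
    have h4 := abs_le.1 hγ.2
    refine ⟨⟨h4.1, h4.2⟩, ?_, hτ⟩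
    change 1 / 2 ≤ τ.im
    nlinarith [τ.im_pos]

/-- There is no nonzero holomorphic function on the upper half-plane, bounded at infinity, which
transforms under `SL(2, ℤ)` by a nontrivial irreducible isometric representation. -/
theorem eq_zero_of_equivariant_of_bounded
    (ρ : SL(2, ℤ) →* Module.End ℂ V) (hunit : ∀ (γ : SL(2, ℤ)) (v : V), ‖ρ γ v‖ = ‖v‖)
    (hirr : ∀ W : Submodule ℂ V, (∀ γ : SL(2, ℤ), W.map (ρ γ) ≤ W) → W = ⊥ ∨ W = ⊤)
    (hnontriv : ∃ γ : SL(2, ℤ), ρ γ ≠ LinearMap.id) {f : ℂ → V}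
    (hf : DifferentiableOn ℂ f {z : ℂ | 0 < z.im}) {A C : ℝ}
    (hC : ∀ z : ℂ, A ≤ z.im → ‖f z‖ ≤ C)
    (hinv : ∀ (γ : SL(2, ℤ)) (τ : UpperHalfPlane), f (γ • τ : UpperHalfPlane) = ρ γ (f τ))
    {z : ℂ} (hz : 0 < z.im) : f z = 0 := by
  obtain ⟨z₀, hz₀, hmax⟩ := exists_norm_le_of_norm_invariant hf hC fun γ τ => by
    rw [hinv, hunit]
  obtain ⟨ℓ, hℓ, hℓz⟩ := exists_dual_vector'' ℂ (f z₀)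
  have hconst (w : ℂ) (hw : 0 < w.im) : ℓ (f w) = ℓ (f z₀) := by
    refine Complex.eqOn_of_isPreconnected_of_isMaxOn_norm (f := fun w => ℓ (f w))
      (convex_halfSpace_im_gt 0).isPreconnected
      (isOpen_lt continuous_const Complex.continuous_im)
      (ℓ.differentiable.comp_differentiableOn hf) hz₀ (fun w hw => ?_) hw
    simp only [Set.mem_ofPred_eq, Function.comp_apply]
    rw [hℓz]
    simpa using (ℓ.le_of_opNorm_le hℓ (f w)).trans (by simpa using hmax w hw)
  set W : Submodule ℂ V := Submodule.span ℂ
    {v | ∃ τ τ' : UpperHalfPlane, v = f τ - f τ'} with hW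
  have hWinv (γ : SL(2, ℤ)) : W.map (ρ γ) ≤ W := by
    rw [hW, Submodule.map_span, Submodule.span_le]
    rintro _ ⟨_, ⟨τ, τ', rfl⟩, rfl⟩
    exact Submodule.subset_span ⟨γ • τ, γ • τ', by rw [hinv, hinv, map_sub]⟩
  rcases hirr W hWinv with h | h
  · have hfc (τ τ' : UpperHalfPlane) : f τ = f τ' := by
      rw [← sub_eq_zero, ← Submodule.mem_bot ℂ, ← h]
      exact Submodule.subset_span ⟨τ, τ', rfl⟩
    have hfix (γ : SL(2, ℤ)) : ρ γ (f z) = f z := by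
      rw [← hinv γ ⟨z, hz⟩]
      exact hfc _ ⟨z, hz⟩
    let W' : Submodule ℂ V := ⨅ γ, LinearMap.ker (ρ γ - LinearMap.id)
    have hmem (v : V) : v ∈ W' ↔ ∀ γ, ρ γ v = v := by
      simp [W', Submodule.mem_iInf, sub_eq_zero]
    rcases hirr W' (fun γ => by
      rintro _ ⟨v, hv, rfl⟩
      rwa [(hmem v).1 hv γ]) with h' | h'
    · rw [← Submodule.mem_bot ℂ, ← h']
      exact (hmem _).2 hfix
    · obtain ⟨γ, hγ⟩ := hnontriv
      exact absurd (LinearMap.ext fun v => (hmem v).1 (h' ▸ Submodule.mem_top) γ) hγ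
  · have hker : W ≤ LinearMap.ker (ℓ : V →ₗ[ℂ] ℂ) := by
      rw [hW, Submodule.span_le]
      rintro _ ⟨τ, τ', rfl⟩
      simp [hconst τ τ.im_pos, hconst τ' τ'.im_pos]
    have h0 : ℓ (f z₀) = 0 := hker (h ▸ Submodule.mem_top)
    rw [hℓz] at h0
    have h1 : ‖f z₀‖ = 0 := by simpa using h0
    exact norm_le_zero_iff.1 (h1 ▸ hmax z hz)

end

/-- A quasimodular form of weight 2 and nontrivial irreducible unitary type `ρ` is a
genuine modular form: if the completion `G(τ) = F(τ) + y⁻¹ F₂(τ)` is invariant under the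
weight-2 slash action of type `ρ`, with `F`, `F₂` holomorphic and bounded at infinity,
then `F₂ = 0` and `F` is itself a weight-2 modular form of type `ρ`. -/
theorem quasimodular_weight_two_is_modular {V : Type*} [NormedAddCommGroup V]
    [NormedSpace ℂ V] [FiniteDimensional ℂ V]
    (ρ : Matrix.SpecialLinearGroup (Fin 2) ℤ →* Module.End ℂ V)
    (hunit : ∀ (γ : Matrix.SpecialLinearGroup (Fin 2) ℤ) (v : V), ‖ρ γ v‖ = ‖v‖)
    (hirr : ∀ W : Submodule ℂ V,
      (∀ γ : Matrix.SpecialLinearGroup (Fin 2) ℤ, W.map (ρ γ) ≤ W) → W = ⊥ ∨ W = ⊤)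
    (hnontriv : ∃ γ : Matrix.SpecialLinearGroup (Fin 2) ℤ, ρ γ ≠ LinearMap.id)
    (F F₂ : ℂ → V)
    (hFhol : DifferentiableOn ℂ F {z : ℂ | 0 < z.im})
    (hF₂hol : DifferentiableOn ℂ F₂ {z : ℂ | 0 < z.im})
    (hFbdd : ∃ C A : ℝ, ∀ z : ℂ, A ≤ z.im → ‖F z‖ ≤ C ∧ ‖F₂ z‖ ≤ C)
    (hinv : ∀ γ : Matrix.SpecialLinearGroup (Fin 2) ℤ, ∀ z : ℂ, 0 < z.im →
      F ((((γ.1 0 0 : ℤ) : ℂ) * z + ((γ.1 0 1 : ℤ) : ℂ)) /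
            (((γ.1 1 0 : ℤ) : ℂ) * z + ((γ.1 1 1 : ℤ) : ℂ)))
        + (((((γ.1 0 0 : ℤ) : ℂ) * z + ((γ.1 0 1 : ℤ) : ℂ)) /
            (((γ.1 1 0 : ℤ) : ℂ) * z + ((γ.1 1 1 : ℤ) : ℂ))).im)⁻¹ •
          F₂ ((((γ.1 0 0 : ℤ) : ℂ) * z + ((γ.1 0 1 : ℤ) : ℂ)) /
            (((γ.1 1 0 : ℤ) : ℂ) * z + ((γ.1 1 1 : ℤ) : ℂ)))
      = ((((γ.1 1 0 : ℤ) : ℂ) * z + ((γ.1 1 1 : ℤ) : ℂ)) ^ 2) •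
          ρ γ (F z + ((z.im)⁻¹ : ℝ) • F₂ z)) :
    (∀ z : ℂ, 0 < z.im → F₂ z = 0)
    ∧ (∀ γ : Matrix.SpecialLinearGroup (Fin 2) ℤ, ∀ z : ℂ, 0 < z.im →
        F ((((γ.1 0 0 : ℤ) : ℂ) * z + ((γ.1 0 1 : ℤ) : ℂ)) /
              (((γ.1 1 0 : ℤ) : ℂ) * z + ((γ.1 1 1 : ℤ) : ℂ)))
          = ((((γ.1 1 0 : ℤ) : ℂ) * z + ((γ.1 1 1 : ℤ) : ℂ)) ^ 2) • ρ γ (F z)) := by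
  obtain ⟨C, A, hCA⟩ := hFbdd
  have hequiv (γ : SL(2, ℤ)) (τ : UpperHalfPlane) :
      F₂ (γ • τ : UpperHalfPlane) = ρ γ (F₂ τ) := by
    set D : ℂ → ℂ := fun z => ((γ.1 1 0 : ℤ) : ℂ) * z + ((γ.1 1 1 : ℤ) : ℂ) with hD
    set w : ℂ → ℂ := fun z => (((γ.1 0 0 : ℤ) : ℂ) * z + ((γ.1 0 1 : ℤ) : ℂ)) / D z with hw
    have hD0 (z : ℂ) (hz : 0 < z.im) : D z ≠ 0 := int_mul_add_ne_zero γ hz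
    have hDd : Differentiable ℂ D := by fun_prop
    have hwd : DifferentiableOn ℂ w {z : ℂ | 0 < z.im} :=
      DifferentiableOn.div (by fun_prop) hDd.differentiableOn hD0
    have hwU : Set.MapsTo w {z : ℂ | 0 < z.im} {z : ℂ | 0 < z.im} :=
      fun z hz => im_int_div_pos γ hz
    have hFw := hFhol.comp hwd hwU
    have hF₂w := hF₂hol.comp hwd hwU
    have hρF := (LinearMap.toContinuousLinearMap (ρ γ)).differentiable.comp_differentiableOn hFhol
    have hρF₂ := (LinearMap.toContinuousLinearMap (ρ γ)).differentiable.comp_differentiableOn hF₂hol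
    have hf : DifferentiableOn ℂ (fun z => D z ^ 2 • ρ γ (F z)
        + (2 * Complex.I * ((γ.1 1 0 : ℤ) : ℂ) * D z) • F₂ (w z) - F (w z))
        {z : ℂ | 0 < z.im} :=
      (((hDd.pow 2).differentiableOn.smul hρF).add
        ((hDd.const_mul _).differentiableOn.smul hF₂w)).sub hFw
    have hg : DifferentiableOn ℂ (fun z => D z ^ 2 • (F₂ (w z) - ρ γ (F₂ z)))
        {z : ℂ | 0 < z.im} :=
      (hDd.pow 2).differentiableOn.smul (hF₂w.sub hρF₂)
    have hgf (z : ℂ) (hz : 0 < z.im) : D z ^ 2 • (F₂ (w z) - ρ γ (F₂ z)) =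
        z.im • (D z ^ 2 • ρ γ (F z)
          + (2 * Complex.I * ((γ.1 1 0 : ℤ) : ℂ) * D z) • F₂ (w z) - F (w z)) := by
      have h : F (w z) + (w z).im⁻¹ • F₂ (w z) = D z ^ 2 • ρ γ (F z + (z.im⁻¹ : ℝ) • F₂ z) :=
        hinv γ z hz
      have him : (w z).im = z.im / Complex.normSq (D z) := im_int_div γ hz
      have hy : (z.im : ℂ) ≠ 0 := by exact_mod_cast hz.ne'
      have hconj : (starRingEnd ℂ) (D z) =
          D z - 2 * Complex.I * ((γ.1 1 0 : ℤ) : ℂ) * z.im := by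
        apply Complex.ext <;> simp [hD]
        ring
      have hns : (((w z).im⁻¹ : ℝ) : ℂ) =
          (z.im : ℂ)⁻¹ * (D z * (D z - 2 * Complex.I * ((γ.1 1 0 : ℤ) : ℂ) * z.im)) := by
        rw [him, ← hconj, Complex.mul_conj]
        push_cast
        rw [inv_div, div_eq_inv_mul]
      rw [← Complex.coe_smul, hns, ← Complex.coe_smul (z.im⁻¹), map_add, map_smul,
        ← eq_sub_iff_add_eq] at h
      rw [h, ← Complex.coe_smul]
      push_cast
      match_scalars <;> field_simp <;> ring
    have h0 (z : ℂ) (hz : 0 < z.im) := eq_zero_of_eq_im_smul hf hg hgf hz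
    have h1 := hgf τ τ.im_pos
    rw [h0 τ τ.im_pos, smul_zero, smul_eq_zero] at h1
    rw [UpperHalfPlane.coe_smul_eq_int_div]
    exact sub_eq_zero.1 (h1.resolve_left (pow_ne_zero 2 (hD0 τ τ.im_pos)))
  have hF₂ (z : ℂ) (hz : 0 < z.im) : F₂ z = 0 :=
    eq_zero_of_equivariant_of_bounded ρ hunit hirr hnontriv hF₂hol
      (fun w hw => (hCA w hw).2) hequiv hz
  refine ⟨hF₂, fun γ z hz => ?_⟩
  have h := hinv γ z hz
  rwa [hF₂ z hz, hF₂ _ (im_int_div_pos γ hz), smul_zero, smul_zero, add_zero, add_zero] at h
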